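/- arXiv:2605.20598 — 6 statements merged into one kernel-verified Lean document; each statement's English description precedes it below -/
import Mathlib

section
/- Let π' be a group and s ≥ 1 an integer. Let F be the free group on generators v_2, …, v_s; set v_1 := e and u_{ij} := v_i^{-1} v_j for 1 ≤ i, j ≤ s. For y ∈ π', write [y]_i for the image of y in the i-th factor of the free product π' * ⋯ * π' (s copies). Let Q be the quotient of the free product (π' * ⋯ * π') * F (s copies of π', one copy of F) by the normal closure of the set of elements u_{ij}^{-1} [y]_i u_{ij} [y]_j^{-1} for all 1 ≤ i, j ≤ s and all y ∈ π'. Then the homomorphism π' * F → Q determined by sending y ∈ π' to the class of [y]_1 and each v_j to the class of v_j is an isomorphism of groups. -/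
namespace ProEtaleStmt3

/-- The free product of `s` copies of `π'` with the free group `F` on `s - 1`
generators. -/
abbrev P (π' : Type*) [Group π'] (s : ℕ) : Type _ :=
  Monoid.Coprod (Monoid.CoprodI (fun _ : Fin s => π')) (FreeGroup (Fin (s - 1)))

/-- `[y]ᵢ` : the embedding of the `i`-th copy of `π'` into `P`. -/
def br (π' : Type*) [Group π'] (s : ℕ) (i : Fin s) : π' →* P π' s :=
  (Monoid.Coprod.inl).comp (@Monoid.CoprodI.of (Fin s) (fun _ => π') _ i)

/-- `v i` : the element of `P` given by `v 0 = 1` and, for `i ≥ 1`, the image of the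
`i`-th free generator of the free group `F` on `s - 1` generators. -/
def v (π' : Type*) [Group π'] (s : ℕ) (i : Fin s) : P π' s :=
  if h : i.1 = 0 then 1
  else Monoid.Coprod.inr (FreeGroup.of (⟨i.1 - 1, by have := i.2; omega⟩ : Fin (s - 1)))

/-- `u i j := v i ⁻¹ * v j`. -/
def u (π' : Type*) [Group π'] (s : ℕ) (i j : Fin s) : P π' s :=
  (v π' s i)⁻¹ * v π' s j

/-- The relators `u i j ⁻¹ * [y]ᵢ * u i j * [y]ⱼ⁻¹`. -/
def R (π' : Type*) [Group π'] (s : ℕ) : Set (P π' s) :=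
  {x | ∃ (i j : Fin s) (y : π'),
    x = (u π' s i j)⁻¹ * br π' s i y * u π' s i j * (br π' s j y)⁻¹}

/-- The image of `v i` in `π' * F`. -/
def w (π' : Type*) [Group π'] (s : ℕ) (i : Fin s) :
    Monoid.Coprod π' (FreeGroup (Fin (s - 1))) :=
  if h : i.1 = 0 then 1
  else Monoid.Coprod.inr (FreeGroup.of (⟨i.1 - 1, by have := i.2; omega⟩ : Fin (s - 1)))

/-- The homomorphism `P → π' * F` sending `[y]ᵢ` to `(w i)⁻¹ * y * w i` and restricting to the
inclusion on `F`. -/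
def retract (π' : Type*) [Group π'] (s : ℕ) :
    P π' s →* Monoid.Coprod π' (FreeGroup (Fin (s - 1))) :=
  Monoid.Coprod.lift
    (Monoid.CoprodI.lift fun i =>
      (MulAut.conj (w π' s i)⁻¹).toMonoidHom.comp Monoid.Coprod.inl)
    Monoid.Coprod.inr

theorem retract_br (π' : Type*) [Group π'] (s : ℕ) (i : Fin s) (y : π') :
    retract π' s (br π' s i y) = (w π' s i)⁻¹ * Monoid.Coprod.inl y * w π' s i := by
  simp [retract, br]

theorem retract_v (π' : Type*) [Group π'] (s : ℕ) (i : Fin s) :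
    retract π' s (v π' s i) = w π' s i := by
  unfold v w
  split_ifs <;> simp [retract]

theorem normalClosure_R_le_ker_retract (π' : Type*) [Group π'] (s : ℕ) :
    Subgroup.normalClosure (R π' s) ≤ (retract π' s).ker := by
  refine Subgroup.normalClosure_le_normal ?_
  rintro _ ⟨i, j, y, rfl⟩
  simp only [SetLike.mem_coe, MonoidHom.mem_ker, u, map_mul, map_inv, retract_br, retract_v]
  group

theorem mk_br (π' : Type*) [Group π'] (s : ℕ) (i j : Fin s) (y : π') :
    QuotientGroup.mk' (Subgroup.normalClosure (R π' s)) (br π' s j y) =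
      QuotientGroup.mk' (Subgroup.normalClosure (R π' s))
        ((u π' s i j)⁻¹ * br π' s i y * u π' s i j) := by
  refine (mul_inv_eq_one.mp ?_).symm
  rw [← map_inv, ← map_mul, ← MonoidHom.mem_ker, QuotientGroup.ker_mk']
  exact Subgroup.subset_normalClosure ⟨i, j, y, rfl⟩

/-- (Lemma 1.7, discrete case.)  The homomorphism from `π' * F` to the quotient
`Q` of `(π' * ⋯ * π') * F` by the normal closure of the relators
`u i j ⁻¹ [y]ᵢ u i j [y]ⱼ⁻¹`, determined by `y ↦ [y]₁` and `v j ↦ v j`, is an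
isomorphism of groups. -/
theorem proetale_stmt3 (π' : Type*) [Group π'] (s : ℕ) (hs : 1 ≤ s) :
    Function.Bijective
      (Monoid.Coprod.lift
        ((QuotientGroup.mk' (Subgroup.normalClosure (R π' s))).comp (br π' s ⟨0, hs⟩))
        ((QuotientGroup.mk' (Subgroup.normalClosure (R π' s))).comp
          (Monoid.Coprod.inr : FreeGroup (Fin (s - 1)) →* P π' s))) := by
  constructor
  · refine Function.LeftInverse.injective
      (g := QuotientGroup.lift _ (retract π' s) (normalClosure_R_le_ker_retract π' s)) fun x => ?_
    refine DFunLike.congr_fun (f := (QuotientGroup.lift _ (retract π' s)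
      (normalClosure_R_le_ker_retract π' s)).comp _) (g := MonoidHom.id _) ?_ x
    ext y
    · simp [retract_br, w]
    · simp [retract]
  · rw [← MonoidHom.range_eq_top, ← top_le_iff]
    set f := Monoid.Coprod.lift
        ((QuotientGroup.mk' (Subgroup.normalClosure (R π' s))).comp (br π' s ⟨0, hs⟩))
        ((QuotientGroup.mk' (Subgroup.normalClosure (R π' s))).comp
          (Monoid.Coprod.inr : FreeGroup (Fin (s - 1)) →* P π' s)) with hf
    have mem_inr (x : FreeGroup (Fin (s - 1))) :
        QuotientGroup.mk' (Subgroup.normalClosure (R π' s)) (Monoid.Coprod.inr x) ∈ f.range :=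
      ⟨Monoid.Coprod.inr x, by simp [hf]⟩
    have mem_v (i : Fin s) :
        QuotientGroup.mk' (Subgroup.normalClosure (R π' s)) (v π' s i) ∈ f.range := by
      unfold v
      split_ifs
      · rw [map_one]
        exact one_mem _
      · exact mem_inr _
    have mem_u (i j : Fin s) :
        QuotientGroup.mk' (Subgroup.normalClosure (R π' s)) (u π' s i j) ∈ f.range := by
      rw [u, map_mul, map_inv]
      exact mul_mem (inv_mem (mem_v i)) (mem_v j)
    have mem_br (j : Fin s) (y : π') :
        QuotientGroup.mk' (Subgroup.normalClosure (R π' s)) (br π' s j y) ∈ f.range := by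
      rw [mk_br π' s ⟨0, hs⟩ j y, map_mul, map_mul, map_inv]
      exact mul_mem (mul_mem (inv_mem (mem_u _ _)) ⟨Monoid.Coprod.inl y, by simp [hf]⟩)
        (mem_u _ _)
    rintro q -
    obtain ⟨x, rfl⟩ := QuotientGroup.mk'_surjective _ q
    induction x using Monoid.Coprod.induction_on with
    | inl m =>
      induction m using Monoid.CoprodI.induction_on with
      | one =>
        rw [map_one, map_one]
        exact one_mem _
      | of i y => exact mem_br i y
      | mul a b ha hb =>
        rw [map_mul, map_mul]
        exact mul_mem ha hb
    | inr n => exact mem_inr n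
    | mul a b ha hb =>
      rw [map_mul]
      exact mul_mem ha hb

end ProEtaleStmt3
end

section
/- Let π, π', π''_1, …, π''_s be groups (s ≥ 1) and let ψ_i : π''_i → π and φ_i : π''_i → π' be group homomorphisms. Let F be the free group on generators v_2, …, v_s; set v_1 := e and u_{ij} := v_i^{-1} v_j. For y ∈ π', write [y]_i for the image of y in the i-th factor of the s-fold free product π' * ⋯ * π'. Define: (A) the quotient of π * π' * F by the normal closure of the elements ψ_i(a) · (v_i^{-1} φ_i(a) v_i)^{-1} for all a ∈ π''_i and 1 ≤ i ≤ s; and (B) the quotient of π * (π' * ⋯ * π') * F (s copies of π') by the normal closure of the elements u_{ij}^{-1} [y]_i u_{ij} [y]_j^{-1} (all 1 ≤ i, j ≤ s, y ∈ π') together with the elements ψ_i(a) · [φ_i(a)]_i^{-1} (all a ∈ π''_i, 1 ≤ i ≤ s). Then A and B are isomorphic as groups, by an isomorphism that is the identity on the images of π and of F and sends the class of y ∈ π' in A to the class of [y]_1 in B. -/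
namespace ProEtaleStmt4

/-- The free product `π * π' * F` where `F` is free on `s - 1` generators. -/
abbrev GA (π π' : Type*) [Group π] [Group π'] (s : ℕ) : Type _ :=
  Monoid.Coprod (Monoid.Coprod π π') (FreeGroup (Fin (s - 1)))

/-- The free product `π * (π' * ⋯ * π') * F` (with `s` copies of `π'`). -/
abbrev GB (π π' : Type*) [Group π] [Group π'] (s : ℕ) : Type _ :=
  Monoid.Coprod (Monoid.Coprod π (Monoid.CoprodI (fun _ : Fin s => π')))
    (FreeGroup (Fin (s - 1)))

/-- The embedding of `π` into `π * π' * F`. -/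
def iπA (π π' : Type*) [Group π] [Group π'] (s : ℕ) : π →* GA π π' s :=
  (Monoid.Coprod.inl).comp Monoid.Coprod.inl

/-- The embedding of `π'` into `π * π' * F`. -/
def iπ'A (π π' : Type*) [Group π] [Group π'] (s : ℕ) : π' →* GA π π' s :=
  (Monoid.Coprod.inl).comp Monoid.Coprod.inr

/-- The embedding of `F` into `π * π' * F`. -/
def iFA (π π' : Type*) [Group π] [Group π'] (s : ℕ) :
    FreeGroup (Fin (s - 1)) →* GA π π' s :=
  Monoid.Coprod.inr

/-- The elements `v i` of `π * π' * F` : `v 0 = 1`, and `v i` is the `i`-th free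
generator of `F` for `i ≥ 1`. -/
def vA (π π' : Type*) [Group π] [Group π'] (s : ℕ) (i : Fin s) : GA π π' s :=
  if h : i.1 = 0 then 1
  else iFA π π' s (FreeGroup.of (⟨i.1 - 1, by have := i.2; omega⟩ : Fin (s - 1)))

/-- The embedding of `π` into `π * (π' * ⋯ * π') * F`. -/
def iπB (π π' : Type*) [Group π] [Group π'] (s : ℕ) : π →* GB π π' s :=
  (Monoid.Coprod.inl).comp Monoid.Coprod.inl

/-- `[·]ᵢ` : the embedding of the `i`-th copy of `π'` into `π * (π' * ⋯ * π') * F`. -/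
def brB (π π' : Type*) [Group π] [Group π'] (s : ℕ) (i : Fin s) : π' →* GB π π' s :=
  (Monoid.Coprod.inl).comp
    ((Monoid.Coprod.inr).comp (@Monoid.CoprodI.of (Fin s) (fun _ => π') _ i))

/-- The embedding of `F` into `π * (π' * ⋯ * π') * F`. -/
def iFB (π π' : Type*) [Group π] [Group π'] (s : ℕ) :
    FreeGroup (Fin (s - 1)) →* GB π π' s :=
  Monoid.Coprod.inr

/-- The elements `v i` in `π * (π' * ⋯ * π') * F`. -/
def vB (π π' : Type*) [Group π] [Group π'] (s : ℕ) (i : Fin s) : GB π π' s :=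
  if h : i.1 = 0 then 1
  else iFB π π' s (FreeGroup.of (⟨i.1 - 1, by have := i.2; omega⟩ : Fin (s - 1)))

/-- `u i j := v i ⁻¹ * v j` in `π * (π' * ⋯ * π') * F`. -/
def uB (π π' : Type*) [Group π] [Group π'] (s : ℕ) (i j : Fin s) : GB π π' s :=
  (vB π π' s i)⁻¹ * vB π π' s j

/-- The relators of description (A): `ψᵢ(a) * (vᵢ⁻¹ φᵢ(a) vᵢ)⁻¹`. -/
def RA (π π' : Type*) [Group π] [Group π'] (s : ℕ) (π'' : Fin s → Type*)
    [∀ i, Group (π'' i)] (ψ : ∀ i, π'' i →* π) (φ : ∀ i, π'' i →* π') :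
    Set (GA π π' s) :=
  {x | ∃ (i : Fin s) (a : π'' i),
    x = iπA π π' s (ψ i a) *
      ((vA π π' s i)⁻¹ * iπ'A π π' s (φ i a) * vA π π' s i)⁻¹}

/-- The relators of description (B): `u i j ⁻¹ [y]ᵢ u i j [y]ⱼ⁻¹` and
`ψᵢ(a) * [φᵢ(a)]ᵢ⁻¹`. -/
def RB (π π' : Type*) [Group π] [Group π'] (s : ℕ) (π'' : Fin s → Type*)
    [∀ i, Group (π'' i)] (ψ : ∀ i, π'' i →* π) (φ : ∀ i, π'' i →* π') :
    Set (GB π π' s) :=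
  {x | ∃ (i j : Fin s) (y : π'),
      x = (uB π π' s i j)⁻¹ * brB π π' s i y * uB π π' s i j * (brB π π' s j y)⁻¹} ∪
  {x | ∃ (i : Fin s) (a : π'' i),
      x = iπB π π' s (ψ i a) * (brB π π' s i (φ i a))⁻¹}

section vanKampen

variable {π π' : Type*} [Group π] [Group π'] {s : ℕ}

theorem vA_zero (h : 0 < s) : vA π π' s ⟨0, h⟩ = 1 := dif_pos rfl

theorem vB_zero (h : 0 < s) : vB π π' s ⟨0, h⟩ = 1 := dif_pos rfl

/-- A homomorphism matching the two embeddings of `F` matches the elements `v i`. -/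
theorem map_vA_eq_map_vB {K : Type*} [Group K] {f : GA π π' s →* K} {g : GB π π' s →* K}
    (h : ∀ w, f (iFA π π' s w) = g (iFB π π' s w)) (i : Fin s) :
    f (vA π π' s i) = g (vB π π' s i) := by
  unfold vA vB
  split_ifs
  · simp
  · exact h _

/-- Homomorphisms out of `π * π' * F` are determined on the three factors. -/
theorem GA_hom_ext {K : Type*} [Monoid K] {f g : GA π π' s →* K}
    (h₁ : ∀ x, f (iπA π π' s x) = g (iπA π π' s x))
    (h₂ : ∀ y, f (iπ'A π π' s y) = g (iπ'A π π' s y))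
    (h₃ : ∀ w, f (iFA π π' s w) = g (iFA π π' s w)) : f = g :=
  Monoid.Coprod.hom_ext
    (Monoid.Coprod.hom_ext (MonoidHom.ext h₁) (MonoidHom.ext h₂)) (MonoidHom.ext h₃)

/-- Homomorphisms out of `π * (π' * ⋯ * π') * F` are determined on the factors. -/
theorem GB_hom_ext {K : Type*} [Monoid K] {f g : GB π π' s →* K}
    (h₁ : ∀ x, f (iπB π π' s x) = g (iπB π π' s x))
    (h₂ : ∀ i y, f (brB π π' s i y) = g (brB π π' s i y))
    (h₃ : ∀ w, f (iFB π π' s w) = g (iFB π π' s w)) : f = g :=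
  Monoid.Coprod.hom_ext
    (Monoid.Coprod.hom_ext (MonoidHom.ext h₁)
      (Monoid.CoprodI.ext_hom _ _ fun i => MonoidHom.ext (h₂ i)))
    (MonoidHom.ext h₃)

/-- The homomorphism `π * π' * F → π * (π' * ⋯ * π') * F` sending `y` to `[y]₁`. -/
def homAB (π π' : Type*) [Group π] [Group π'] {s : ℕ} (hs : 1 ≤ s) :
    GA π π' s →* GB π π' s :=
  Monoid.Coprod.lift (Monoid.Coprod.lift (iπB π π' s) (brB π π' s ⟨0, hs⟩)) (iFB π π' s)

/-- The homomorphism `π * (π' * ⋯ * π') * F → π * π' * F` sending `[y]ᵢ` to `vᵢ⁻¹ y vᵢ`. -/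
def homBA (π π' : Type*) [Group π] [Group π'] (s : ℕ) : GB π π' s →* GA π π' s :=
  Monoid.Coprod.lift
    (Monoid.Coprod.lift (iπA π π' s)
      (Monoid.CoprodI.lift fun i =>
        (MulAut.conj (vA π π' s i)⁻¹).toMonoidHom.comp (iπ'A π π' s)))
    (iFA π π' s)

section homAB

variable (hs : 1 ≤ s)

theorem homAB_iπA (x : π) : homAB π π' hs (iπA π π' s x) = iπB π π' s x := rfl

theorem homAB_iπ'A (y : π') : homAB π π' hs (iπ'A π π' s y) = brB π π' s ⟨0, hs⟩ y := rfl

theorem homAB_iFA (w : FreeGroup (Fin (s - 1))) :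
    homAB π π' hs (iFA π π' s w) = iFB π π' s w := rfl

theorem homAB_vA (i : Fin s) : homAB π π' hs (vA π π' s i) = vB π π' s i :=
  map_vA_eq_map_vB (K := GB π π' s) (f := homAB π π' hs) (g := MonoidHom.id _) (homAB_iFA hs) i

theorem homAB_inv (x : GA π π' s) : homAB π π' hs x⁻¹ = (homAB π π' hs x)⁻¹ :=
  MonoidHom.map_inv (α := GA π π' s) (β := GB π π' s) (homAB π π' hs) x

end homAB

theorem homBA_iπB (x : π) : homBA π π' s (iπB π π' s x) = iπA π π' s x := rfl

theorem homBA_brB (i : Fin s) (y : π') :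
    homBA π π' s (brB π π' s i y) =
      (vA π π' s i)⁻¹ * iπ'A π π' s y * vA π π' s i := by
  simp [homBA, brB]

theorem homBA_iFB (w : FreeGroup (Fin (s - 1))) :
    homBA π π' s (iFB π π' s w) = iFA π π' s w := rfl

theorem homBA_inv (x : GB π π' s) : homBA π π' s x⁻¹ = (homBA π π' s x)⁻¹ :=
  MonoidHom.map_inv _ x

theorem homBA_vB (i : Fin s) : homBA π π' s (vB π π' s i) = vA π π' s i :=
  (map_vA_eq_map_vB (f := MonoidHom.id _) (fun w => (homBA_iFB w).symm) i).symm

variable {π'' : Fin s → Type*} [∀ i, Group (π'' i)]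
  {ψ : ∀ i, π'' i →* π} {φ : ∀ i, π'' i →* π'}

/-- In the quotient (A), `ψᵢ(a) = vᵢ⁻¹ φᵢ(a) vᵢ`. -/
theorem mk_iπA (i : Fin s) (a : π'' i) :
    QuotientGroup.mk' (Subgroup.normalClosure (RA π π' s π'' ψ φ)) (iπA π π' s (ψ i a)) =
      QuotientGroup.mk' (Subgroup.normalClosure (RA π π' s π'' ψ φ))
        ((vA π π' s i)⁻¹ * iπ'A π π' s (φ i a) * vA π π' s i) := by
  rw [← mul_inv_eq_one, ← map_inv, ← map_mul]
  exact (QuotientGroup.eq_one_iff _).2 (Subgroup.subset_normalClosure ⟨i, a, rfl⟩)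

/-- In the quotient (B), `[y]ᵢ = vᵢ⁻¹ [y]₁ vᵢ`. -/
theorem mk_brB (hs : 1 ≤ s) (i : Fin s) (y : π') :
    QuotientGroup.mk' (Subgroup.normalClosure (RB π π' s π'' ψ φ))
        ((vB π π' s i)⁻¹ * brB π π' s ⟨0, hs⟩ y * vB π π' s i) =
      QuotientGroup.mk' (Subgroup.normalClosure (RB π π' s π'' ψ φ)) (brB π π' s i y) := by
  rw [← mul_inv_eq_one, ← map_inv, ← map_mul]
  refine (QuotientGroup.eq_one_iff _).2
    (Subgroup.subset_normalClosure (Or.inl ⟨⟨0, hs⟩, i, y, ?_⟩))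
  simp [uB, vB_zero]

/-- In the quotient (B), `ψᵢ(a) = [φᵢ(a)]ᵢ`. -/
theorem mk_iπB (i : Fin s) (a : π'' i) :
    QuotientGroup.mk' (Subgroup.normalClosure (RB π π' s π'' ψ φ)) (iπB π π' s (ψ i a)) =
      QuotientGroup.mk' (Subgroup.normalClosure (RB π π' s π'' ψ φ))
        (brB π π' s i (φ i a)) := by
  rw [← mul_inv_eq_one, ← map_inv, ← map_mul]
  exact (QuotientGroup.eq_one_iff _).2 (Subgroup.subset_normalClosure (Or.inr ⟨i, a, rfl⟩))

theorem normalClosure_RA_le (hs : 1 ≤ s) :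
    Subgroup.normalClosure (RA π π' s π'' ψ φ) ≤
      (Subgroup.normalClosure (RB π π' s π'' ψ φ)).comap (homAB π π' hs) := by
  refine Subgroup.normalClosure_le_normal ?_
  rintro _ ⟨i, a, rfl⟩
  refine (QuotientGroup.eq_one_iff (N := Subgroup.normalClosure (RB π π' s π'' ψ φ)) _).1 ?_
  change QuotientGroup.mk' _ _ = 1
  simp only [map_mul (homAB π π' hs), homAB_inv, homAB_iπA, homAB_iπ'A, homAB_vA]
  exact (mul_inv_eq_one
    (G := GB π π' s ⧸ Subgroup.normalClosure (RB π π' s π'' ψ φ))).2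
    ((mk_iπB i a).trans (mk_brB hs i _).symm)

theorem normalClosure_RB_le :
    Subgroup.normalClosure (RB π π' s π'' ψ φ) ≤
      (Subgroup.normalClosure (RA π π' s π'' ψ φ)).comap (homBA π π' s) := by
  refine Subgroup.normalClosure_le_normal ?_
  rintro _ (⟨i, j, y, rfl⟩ | ⟨i, a, rfl⟩)
  · refine Subgroup.mem_comap.2 ?_
    convert Subgroup.one_mem _
    simp only [uB, map_mul, homBA_inv, homBA_vB, homBA_brB]
    group
  · refine (QuotientGroup.eq_one_iff (N := Subgroup.normalClosure (RA π π' s π'' ψ φ)) _).1 ?_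
    change QuotientGroup.mk' _ _ = 1
    rw [map_mul (homBA π π' s), homBA_inv, homBA_iπB, homBA_brB, map_mul, map_inv, mk_iπA,
      mul_inv_cancel]

end vanKampen

/-- (Lemma 1.8, (i) ↔ (ii), discrete case.)  The two van Kampen presentations
`A = (π * π' * F) / ⟪ψᵢ(a) = vᵢ⁻¹ φᵢ(a) vᵢ⟫` and
`B = (π * (π' * ⋯ * π') * F) / ⟪u i j⁻¹ [y]ᵢ u i j = [y]ⱼ, ψᵢ(a) = [φᵢ(a)]ᵢ⟫`
are isomorphic, by an isomorphism that is the identity on the images of `π` and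
of `F` and sends the class of `y ∈ π'` to the class of `[y]₁`. -/
theorem proetale_stmt4 (π π' : Type*) [Group π] [Group π'] (s : ℕ) (hs : 1 ≤ s)
    (π'' : Fin s → Type*) [∀ i, Group (π'' i)]
    (ψ : ∀ i, π'' i →* π) (φ : ∀ i, π'' i →* π') :
    ∃ e : (GA π π' s ⧸ Subgroup.normalClosure (RA π π' s π'' ψ φ)) ≃*
          (GB π π' s ⧸ Subgroup.normalClosure (RB π π' s π'' ψ φ)),
      (∀ x : π, e (QuotientGroup.mk (iπA π π' s x)) = QuotientGroup.mk (iπB π π' s x)) ∧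
      (∀ w : FreeGroup (Fin (s - 1)),
        e (QuotientGroup.mk (iFA π π' s w)) = QuotientGroup.mk (iFB π π' s w)) ∧
      (∀ y : π',
        e (QuotientGroup.mk (iπ'A π π' s y)) =
          QuotientGroup.mk (brB π π' s (⟨0, hs⟩ : Fin s) y)) := by
  refine ⟨MonoidHom.toMulEquiv
    (QuotientGroup.map _ _ (homAB π π' hs) (normalClosure_RA_le hs))
    (QuotientGroup.map _ _ (homBA π π' s) normalClosure_RB_le) ?_ ?_,
    fun _ => rfl, fun _ => rfl, fun _ => rfl⟩
  · refine QuotientGroup.monoidHom_ext _ (GA_hom_ext (fun _ => rfl) (fun y => ?_) fun _ => rfl)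
    change QuotientGroup.mk' _ (homBA π π' s (homAB π π' hs _)) = QuotientGroup.mk' _ _
    rw [homAB_iπ'A, homBA_brB, vA_zero, inv_one, one_mul, mul_one]
  · refine QuotientGroup.monoidHom_ext _ (GB_hom_ext (fun _ => rfl) (fun i y => ?_) fun _ => rfl)
    change QuotientGroup.mk' _ (homAB π π' hs (homBA π π' s _)) = QuotientGroup.mk' _ _
    rw [homBA_brB, map_mul (homAB π π' hs), map_mul (homAB π π' hs), homAB_inv, homAB_vA,
      homAB_iπ'A, mk_brB]

end ProEtaleStmt4
end

section
/- For each j with 1 ≤ j ≤ m, the set T_j is open in X. -/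
/-
Setting (Section 2.3 of the paper, topological abstraction):
`X` is a nonempty connected Noetherian topological space with irreducible
components `C 0, …, C (n-1)`.  `Z ⊆ X` is a closed subset containing all
pairwise intersections of irreducible components and containing no irreducible
component.  `W 0, …, W (m-1)` are the connected components of `Z`, and
`T j := (⋃_{i : C i ∩ W j ≠ ∅} C i) \ (⋃_{t ≠ j} W t)`.
-/
theorem IsClosed.isClosed_connectedComponentIn {X : Type*} [TopologicalSpace X] {F : Set X}
    (hF : IsClosed F) {x : X} (hx : x ∈ F) : IsClosed (connectedComponentIn F x) :=
  isClosed_of_closure_subset <|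
    isPreconnected_connectedComponentIn.closure.subset_connectedComponentIn
      (subset_closure (mem_connectedComponentIn hx))
      (closure_minimal (connectedComponentIn_subset F x) hF)

/-- Lemma 2.7(1): each `T j` is open in `X`. -/
theorem proetale_stmt5
    {X : Type*} [TopologicalSpace X] [Nonempty X]
    [TopologicalSpace.NoetherianSpace X] [ConnectedSpace X]
    {n m : ℕ}
    (C : Fin n → Set X) (hCinj : Function.Injective C)
    (hCrange : Set.range C = irreducibleComponents X)
    (Z : Set X) (hZclosed : IsClosed Z)
    (hZsing : ∀ i s : Fin n, i ≠ s → C i ∩ C s ⊆ Z)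
    (hZnotcomp : ∀ i, ¬ C i ⊆ Z)
    (W : Fin m → Set X)
    (hWinj : Function.Injective W)
    (hWcc : ∀ j, ∃ x ∈ Z, W j = connectedComponentIn Z x)
    (hWall : (⋃ j, W j) = Z)
    (T : Fin m → Set X)
    (hT : ∀ j, T j = (⋃ i ∈ {i : Fin n | (C i ∩ W j).Nonempty}, C i) \
      (⋃ t ∈ {t : Fin m | t ≠ j}, W t))
    : ∀ j, IsOpen (T j) := by
  intro j
  have hCclosed : ∀ i, IsClosed (C i) := fun i =>
    isClosed_of_mem_irreducibleComponents (C i) (hCrange ▸ Set.mem_range_self i)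
  have hWclosed : ∀ t, IsClosed (W t) := fun t => by
    obtain ⟨x, hxZ, hx⟩ := hWcc t
    exact hx ▸ hZclosed.isClosed_connectedComponentIn hxZ
  have hcover : ∀ x, ∃ i, x ∈ C i := fun x => by
    obtain ⟨i, hi⟩ : irreducibleComponent x ∈ Set.range C :=
      hCrange ▸ irreducibleComponent_mem_irreducibleComponents x
    exact ⟨i, hi ▸ mem_irreducibleComponent⟩
  have hcompl : (T j)ᶜ = (⋃ i ∈ {i : Fin n | ¬ (C i ∩ W j).Nonempty}, C i) ∪
      ⋃ t ∈ {t : Fin m | t ≠ j}, W t := by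
    ext x
    simp only [hT, Set.mem_compl_iff, Set.mem_sdiff, Set.mem_union, Set.mem_iUnion,
      Set.mem_ofPred_eq, exists_prop]
    constructor
    · intro hx
      obtain ⟨i, hi⟩ := hcover x
      by_cases hij : (C i ∩ W j).Nonempty
      · exact Or.inr (by_contra fun h => hx ⟨⟨i, hij, hi⟩, h⟩)
      · exact Or.inl ⟨i, hij, hi⟩
    · rintro (⟨i, hij, hi⟩ | hx) ⟨⟨s, hsj, hs⟩, hne⟩
      · have his : i ≠ s := by
          rintro rfl
          exact hij hsj
        obtain ⟨t, ht⟩ := Set.mem_iUnion.1 (hWall ▸ hZsing i s his ⟨hi, hs⟩)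
        by_cases htj : t = j
        · exact hij ⟨x, hi, htj ▸ ht⟩
        · exact hne ⟨t, htj, ht⟩
      · exact hne hx
  rw [← isClosed_compl_iff, hcompl]
  exact ((Set.toFinite _).isClosed_biUnion fun i _ => hCclosed i).union
    ((Set.toFinite _).isClosed_biUnion fun t _ => hWclosed t)
end

section
/- For each j with 1 ≤ j ≤ m, the identity T_j = (X \ ⋃_{i : X_i ∩ Z_j = ∅} X_i) \ (⋃_{t ≠ j} Z_t) holds; equivalently, every irreducible component X_s with X_s ∩ Z_j = ∅ is disjoint from T_j. -/
/-
Setting (Section 2.3 of the paper, topological abstraction):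
`X` is a nonempty connected Noetherian topological space with irreducible
components `C 0, …, C (n-1)`.  `Z ⊆ X` is a closed subset containing all
pairwise intersections of irreducible components and containing no irreducible
component.  `W 0, …, W (m-1)` are the connected components of `Z`, and
`T j := (⋃_{i : C i ∩ W j ≠ ∅} C i) \ (⋃_{t ≠ j} W t)`.
-/
/-- (Proof of Lemma 2.7(1)): `T j = (X \ ⋃_{i : C i ∩ W j = ∅} C i) \ ⋃_{t ≠ j} W t`;
equivalently, every irreducible component disjoint from `W j` is disjoint from `T j`. -/
theorem proetale_stmt6
    {X : Type*} [TopologicalSpace X] [Nonempty X]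
    [TopologicalSpace.NoetherianSpace X] [ConnectedSpace X]
    {n m : ℕ}
    (C : Fin n → Set X) (hCinj : Function.Injective C)
    (hCrange : Set.range C = irreducibleComponents X)
    (Z : Set X) (hZclosed : IsClosed Z)
    (hZsing : ∀ i s : Fin n, i ≠ s → C i ∩ C s ⊆ Z)
    (hZnotcomp : ∀ i, ¬ C i ⊆ Z)
    (W : Fin m → Set X)
    (hWinj : Function.Injective W)
    (hWcc : ∀ j, ∃ x ∈ Z, W j = connectedComponentIn Z x)
    (hWall : (⋃ j, W j) = Z)
    (T : Fin m → Set X)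
    (hT : ∀ j, T j = (⋃ i ∈ {i : Fin n | (C i ∩ W j).Nonempty}, C i) \
      (⋃ t ∈ {t : Fin m | t ≠ j}, W t))
    : ∀ j : Fin m,
      T j = (Set.univ \ ⋃ i ∈ {i : Fin n | C i ∩ W j = ∅}, C i) \
        (⋃ t ∈ {t : Fin m | t ≠ j}, W t) ∧
      ∀ i : Fin n, C i ∩ W j = ∅ → Disjoint (C i) (T j) := by
  have hdisj : ∀ j i, C i ∩ W j = ∅ → Disjoint (C i) (T j) := by
    intro j i hij
    rw [Set.disjoint_left]
    intro x hxi hxT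
    rw [hT] at hxT
    obtain ⟨hxU, hxW⟩ := hxT
    simp only [Set.mem_iUnion, Set.mem_ofPred_eq, exists_prop] at hxU hxW
    obtain ⟨k, hk, hxk⟩ := hxU
    have hne : i ≠ k := by
      rintro rfl
      exact hk.ne_empty hij
    have hxZ : x ∈ ⋃ t, W t := hWall ▸ hZsing i k hne ⟨hxi, hxk⟩
    obtain ⟨t, ht⟩ := Set.mem_iUnion.mp hxZ
    by_cases htj : t = j
    · subst htj
      exact Set.eq_empty_iff_forall_notMem.mp hij x ⟨hxi, ht⟩
    · exact hxW ⟨t, htj, ht⟩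
  intro j
  refine ⟨Set.Subset.antisymm ?_ ?_, hdisj j⟩
  · intro x hx
    refine ⟨⟨Set.mem_univ x, ?_⟩, ?_⟩
    · simp only [Set.mem_iUnion, Set.mem_ofPred_eq, exists_prop, not_exists, not_and]
      exact fun i hij hxi => Set.disjoint_left.mp (hdisj j i hij) hxi hx
    · rw [hT] at hx
      exact hx.2
  · rintro x ⟨⟨-, hxC⟩, hxW⟩
    rw [hT]
    refine ⟨?_, hxW⟩
    obtain ⟨i, hi⟩ : irreducibleComponent x ∈ Set.range C :=
      hCrange ▸ irreducibleComponent_mem_irreducibleComponents x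
    have hxi : x ∈ C i := hi ▸ mem_irreducibleComponent
    simp only [Set.mem_iUnion, Set.mem_ofPred_eq, exists_prop, not_exists, not_and] at hxC ⊢
    exact ⟨i, Set.nonempty_iff_ne_empty.mpr fun h => hxC i h hxi, hxi⟩
end

section
/- If Z is nonempty (so m ≥ 1), then X = T_1 ∪ ⋯ ∪ T_m. -/
/-
Setting (Section 2.3 of the paper, topological abstraction):
`X` is a nonempty connected Noetherian topological space with irreducible
components `C 0, …, C (n-1)`.  `Z ⊆ X` is a closed subset containing all
pairwise intersections of irreducible components and containing no irreducible
component.  `W 0, …, W (m-1)` are the connected components of `Z`, and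
`T j := (⋃_{i : C i ∩ W j ≠ ∅} C i) \ (⋃_{t ≠ j} W t)`.
-/
/-- In a connected space covered by finitely many closed sets whose pairwise intersections lie in
a nonempty set `Z`, every nonempty member of the cover meets `Z`. -/
theorem inter_nonempty_of_finite_closed_cover {X ι : Type*} [TopologicalSpace X]
    [PreconnectedSpace X] [Finite ι] {C : ι → Set X} (hC : ∀ i, IsClosed (C i))
    (hcover : ⋃ i, C i = Set.univ) {Z : Set X} (hZ : Z.Nonempty)
    (hinter : ∀ i s, i ≠ s → C i ∩ C s ⊆ Z) {i : ι} (hi : (C i).Nonempty) :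
    (C i ∩ Z).Nonempty := by
  by_contra hempty
  have hcompl : (C i)ᶜ = ⋃ s : {s : ι // s ≠ i}, C s := by
    ext x
    simp only [Set.mem_compl_iff, Set.mem_iUnion, Subtype.exists, exists_prop]
    constructor
    · intro hx
      obtain ⟨s, hs⟩ := Set.mem_iUnion.1 (hcover ▸ Set.mem_univ x)
      exact ⟨s, fun h => hx (h ▸ hs), hs⟩
    · rintro ⟨s, hsi, hs⟩ hx
      exact hempty ⟨x, hx, hinter i s hsi.symm ⟨hx, hs⟩⟩
  have hopen : IsOpen (C i) := by
    rw [← isClosed_compl_iff, hcompl]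
    exact isClosed_iUnion_of_finite fun s => hC s
  have huniv : C i = Set.univ := IsClopen.eq_univ ⟨hC i, hopen⟩ hi
  exact hempty (by simpa [huniv] using hZ)

/-- Lemma 2.7(2): if `Z ≠ ∅` (so `m ≥ 1`) then `X = T 0 ∪ ⋯ ∪ T (m-1)`. -/
theorem proetale_stmt8
    {X : Type*} [TopologicalSpace X] [Nonempty X]
    [TopologicalSpace.NoetherianSpace X] [ConnectedSpace X]
    {n m : ℕ}
    (C : Fin n → Set X) (hCinj : Function.Injective C)
    (hCrange : Set.range C = irreducibleComponents X)
    (Z : Set X) (hZclosed : IsClosed Z)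
    (hZsing : ∀ i s : Fin n, i ≠ s → C i ∩ C s ⊆ Z)
    (hZnotcomp : ∀ i, ¬ C i ⊆ Z)
    (W : Fin m → Set X)
    (hWinj : Function.Injective W)
    (hWcc : ∀ j, ∃ x ∈ Z, W j = connectedComponentIn Z x)
    (hWall : (⋃ j, W j) = Z)
    (T : Fin m → Set X)
    (hT : ∀ j, T j = (⋃ i ∈ {i : Fin n | (C i ∩ W j).Nonempty}, C i) \
      (⋃ t ∈ {t : Fin m | t ≠ j}, W t))
    (hZne : Z.Nonempty) (hm : 1 ≤ m) :
    (⋃ j, T j) = Set.univ := by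
  have hclosed : ∀ i, IsClosed (C i) := fun i =>
    isClosed_of_mem_irreducibleComponents _ (hCrange ▸ Set.mem_range_self i)
  have hcover : ⋃ i, C i = Set.univ := by
    refine Set.eq_univ_of_forall fun x => ?_
    obtain ⟨i, hi⟩ : irreducibleComponent x ∈ Set.range C :=
      hCrange ▸ irreducibleComponent_mem_irreducibleComponents x
    exact Set.mem_iUnion.2 ⟨i, hi ▸ mem_irreducibleComponent⟩
  have hdisj : ∀ j t x, x ∈ W j → x ∈ W t → j = t := by
    intro j t x hj ht
    obtain ⟨y, -, hy⟩ := hWcc j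
    obtain ⟨z, -, hz⟩ := hWcc t
    apply hWinj
    rw [hy] at hj ⊢
    rw [hz] at ht ⊢
    rw [connectedComponentIn_eq hj, connectedComponentIn_eq ht]
  refine Set.eq_univ_of_forall fun x => ?_
  obtain ⟨i, hi⟩ := Set.mem_iUnion.1 (hcover ▸ Set.mem_univ x)
  have key : ∃ j, (C i ∩ W j).Nonempty ∧ ∀ t, t ≠ j → x ∉ W t := by
    by_cases hx : x ∈ Z
    · obtain ⟨j, hj⟩ := Set.mem_iUnion.1 (hWall ▸ hx)
      exact ⟨j, ⟨x, hi, hj⟩, fun t htj ht => htj (hdisj t j x ht hj)⟩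
    · obtain ⟨y, hyi, hyZ⟩ :=
        inter_nonempty_of_finite_closed_cover hclosed hcover hZne hZsing ⟨x, hi⟩
      obtain ⟨j, hj⟩ := Set.mem_iUnion.1 (hWall ▸ hyZ)
      exact ⟨j, ⟨y, hyi, hj⟩, fun t _ ht => hx (hWall ▸ Set.mem_iUnion.2 ⟨t, ht⟩)⟩
  obtain ⟨j, hij, hjt⟩ := key
  refine Set.mem_iUnion.2 ⟨j, ?_⟩
  rw [hT]
  refine ⟨Set.mem_biUnion hij hi, fun hmem => ?_⟩
  obtain ⟨t, htj, ht⟩ := Set.mem_iUnion₂.1 hmem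
  exact hjt t htj ht
end

section
/- Assume m ≥ 2. Set T'_1 := T_2 ∪ ⋯ ∪ T_m and let S := { i : X_i ∩ Z_1 ≠ ∅ and X_i ∩ Z_t ≠ ∅ for some t with 2 ≤ t ≤ m }. Then T_1 ∩ T'_1 = ⋃_{i ∈ S} (X_i \ Z). Moreover, for each i ∈ S the set X_i \ Z is nonempty, open in X, and connected, and the sets X_i \ Z for distinct i ∈ S are pairwise disjoint; hence the sets X_i \ Z, i ∈ S, are exactly the connected components of T_1 ∩ T'_1. -/
/-
Setting (Section 2.3 of the paper, topological abstraction):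
`X` is a nonempty connected Noetherian topological space with irreducible
components `C 0, …, C (n-1)`.  `Z ⊆ X` is a closed subset containing all
pairwise intersections of irreducible components and containing no irreducible
component.  `W 0, …, W (m-1)` are the connected components of `Z`, and
`T j := (⋃_{i : C i ∩ W j ≠ ∅} C i) \ (⋃_{t ≠ j} W t)`.
-/
/-- (Proof of Theorem 2.8.)  With `T'₁ := T 1 ∪ ⋯ ∪ T (m-1)` and
`S := {i | C i meets W 0 and C i meets some W t, t ≠ 0}` one has
`T 0 ∩ T'₁ = ⋃_{i ∈ S} (C i \ Z)`, each `C i \ Z` (`i ∈ S`) is nonempty, open and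
connected, the sets `C i \ Z` are pairwise disjoint, and they are exactly the
connected components of `T 0 ∩ T'₁`. -/
theorem proetale_stmt12
    {X : Type*} [TopologicalSpace X] [Nonempty X]
    [TopologicalSpace.NoetherianSpace X] [ConnectedSpace X]
    {n m : ℕ}
    (C : Fin n → Set X) (hCinj : Function.Injective C)
    (hCrange : Set.range C = irreducibleComponents X)
    (Z : Set X) (hZclosed : IsClosed Z)
    (hZsing : ∀ i s : Fin n, i ≠ s → C i ∩ C s ⊆ Z)
    (hZnotcomp : ∀ i, ¬ C i ⊆ Z)
    (W : Fin m → Set X)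
    (hWinj : Function.Injective W)
    (hWcc : ∀ j, ∃ x ∈ Z, W j = connectedComponentIn Z x)
    (hWall : (⋃ j, W j) = Z)
    (T : Fin m → Set X)
    (hT : ∀ j, T j = (⋃ i ∈ {i : Fin n | (C i ∩ W j).Nonempty}, C i) \
      (⋃ t ∈ {t : Fin m | t ≠ j}, W t))
    (hm : 2 ≤ m) (j1 : Fin m) (hj1 : j1.1 = 0)
    (T' : Set X) (hT' : T' = ⋃ t ∈ {t : Fin m | t ≠ j1}, T t)
    (S : Set (Fin n))
    (hS : S = {i : Fin n | (C i ∩ W j1).Nonempty ∧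
      ∃ t : Fin m, t ≠ j1 ∧ (C i ∩ W t).Nonempty}) :
    (T j1 ∩ T' = ⋃ i ∈ S, (C i \ Z)) ∧
    (∀ i ∈ S, (C i \ Z).Nonempty ∧ IsOpen (C i \ Z) ∧ IsConnected (C i \ Z)) ∧
    (∀ i ∈ S, ∀ i' ∈ S, i ≠ i' → (C i \ Z) ∩ (C i' \ Z) = ∅) ∧
    (∀ i ∈ S, ∀ x ∈ C i \ Z, connectedComponentIn (T j1 ∩ T') x = C i \ Z) := by
  have hcl : ∀ i, IsClosed (C i) := fun i =>
    isClosed_of_mem_irreducibleComponents _ (hCrange ▸ Set.mem_range_self i)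
  have hirr : ∀ i, IsIrreducible (C i) := fun i =>
    ((hCrange ▸ Set.mem_range_self i : C i ∈ irreducibleComponents X)).1
  have hcov : ∀ x, ∃ i, x ∈ C i := fun x => by
    have h := irreducibleComponent_mem_irreducibleComponents x
    rw [← hCrange] at h
    obtain ⟨i, hi⟩ := h
    exact ⟨i, hi ▸ mem_irreducibleComponent⟩
  have hne : ∀ i, (C i \ Z).Nonempty := fun i => Set.sdiff_nonempty.mpr (hZnotcomp i)
  have huniq : ∀ {i s x}, x ∈ C i → x ∈ C s → x ∉ Z → i = s := fun {i s x} hi hs hx => by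
    by_contra h
    exact hx (hZsing i s h ⟨hi, hs⟩)
  have hopen : ∀ i, IsOpen (C i \ Z) := fun i => by
    have h : C i \ Z = (Z ∪ ⋃ s ∈ {s | s ≠ i}, C s)ᶜ := by
      ext x
      simp only [Set.mem_sdiff, Set.mem_compl_iff, Set.mem_union, Set.mem_iUnion, Set.mem_ofPred_eq,
        exists_prop, not_or, not_exists, not_and]
      refine ⟨fun ⟨hi, hx⟩ => ⟨hx, fun s hs hxs => hs (huniq hxs hi hx)⟩, fun ⟨hx, h⟩ => ⟨?_, hx⟩⟩
      obtain ⟨s, hs⟩ := hcov x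
      by_cases his : s = i
      · exact his ▸ hs
      · exact absurd hs (h s his)
    rw [h, isOpen_compl_iff]
    exact hZclosed.union ((Set.toFinite _).isClosed_biUnion fun s _ => hcl s)
  have hconn : ∀ i, IsConnected (C i \ Z) := fun i =>
    ⟨hne i, ((hirr i).2.open_subset (hopen i) Set.sdiff_subset).isPreconnected⟩
  have hdisj : ∀ i i', i ≠ i' → Disjoint (C i \ Z) (C i' \ Z) := fun i i' h =>
    Set.disjoint_left.mpr fun x hx hx' => h (huniq hx.1 hx'.1 hx.2)
  have hWZ : ∀ {j x}, x ∈ W j → x ∈ Z := fun {j x} hx => hWall ▸ Set.mem_iUnion_of_mem j hx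
  have hmem : ∀ {j x}, x ∈ T j ↔
      (∃ i, (C i ∩ W j).Nonempty ∧ x ∈ C i) ∧ ∀ t, t ≠ j → x ∉ W t := fun {j x} => by
    rw [hT]
    simp
  have hmain : T j1 ∩ T' = ⋃ i ∈ S, (C i \ Z) := by
    ext x
    simp only [hT', hS, Set.mem_inter_iff, Set.mem_iUnion, Set.mem_ofPred_eq, exists_prop, hmem,
      Set.mem_sdiff]
    constructor
    · rintro ⟨⟨⟨i, hi, hxi⟩, h1⟩, t, ht, ⟨k, hk, hxk⟩, h2⟩
      have hx : x ∉ Z := by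
        rw [← hWall, Set.mem_iUnion]
        rintro ⟨s, hs⟩
        by_cases h : s = j1
        · exact h2 s (h ▸ ht.symm) hs
        · exact h1 s h hs
      obtain rfl := huniq hxi hxk hx
      exact ⟨i, ⟨hi, t, ht, hk⟩, hxi, hx⟩
    · rintro ⟨i, ⟨hi, t, ht, hk⟩, hxi, hx⟩
      exact ⟨⟨⟨i, hi, hxi⟩, fun s _ h => hx (hWZ h)⟩, t, ht, ⟨i, hk, hxi⟩, fun s _ h => hx (hWZ h)⟩
  refine ⟨hmain, fun i _ => ⟨hne i, hopen i, hconn i⟩,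
    fun i _ i' _ h => (hdisj i i' h).inter_eq, fun i hi x hx => ?_⟩
  have hsub : C i \ Z ⊆ T j1 ∩ T' := hmain ▸ Set.subset_biUnion_of_mem (u := fun i => C i \ Z) hi
  refine Set.Subset.antisymm ?_ ((hconn i).2.subset_connectedComponentIn hx hsub)
  refine isPreconnected_connectedComponentIn.subset_left_of_subset_union (hopen i)
    (v := ⋃ k ∈ {k | k ≠ i}, (C k \ Z)) (isOpen_biUnion fun k _ => hopen k) ?_ ?_
    ⟨x, mem_connectedComponentIn (hsub hx), hx⟩
  · exact Set.disjoint_iUnion₂_right.mpr fun k hk => hdisj i k (Ne.symm hk)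
  · refine (connectedComponentIn_subset _ _).trans (hmain.subset.trans ?_)
    refine Set.iUnion₂_subset fun k _ y hy => ?_
    by_cases h : k = i
    · exact Or.inl (h ▸ hy)
    · exact Or.inr (Set.mem_biUnion (show k ∈ {k | k ≠ i} from h) hy)
end
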